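/- Let E be a finite-dimensional real inner product space and L : E → E self-adjoint, and suppose the set of eigenvalues of L admits an α-separated partition Λ_1 ∪ … ∪ Λ_N for some α > 0. Let A : E → E be self-adjoint with ‖A‖ = ε and 0 < ε < α, and set L' = L + A; associate the eigenvalues of L' (listed in nondecreasing order with multiplicity) with the parts of the corresponding eigenvalues of L. Consider a D-layer neural network Φ with F_0 = F_D = 1 and F_l = F for 1 ≤ l ≤ D−1 features per layer, whose layer-l features are f_l^p = σ(Σ_{q=1}^{F_{l-1}} h_l^{pq}(L) f_{l-1}^q) for 1 ≤ p ≤ F_l, with input f_0^1 = f and output Φ(L, f) = f_D^1, where: each filter function h_l^{pq} : ℝ → ℝ is B-Lipschitz, satisfies |h_l^{pq}(λ)| ≤ 1 for all λ, and satisfies |h_l^{pq}(x) − h_l^{pq}(y)| ≤ π ε/(2(α − ε)) whenever x, y are eigenvalues of L or of L' associated with the same part Λ_k; and σ : E → E is 1-Lipschitz with σ(0) = 0. Then ‖Φ(L, f) − Φ(L', f)‖ ≤ D · F^{D−1} · (N π/(α − ε) + B) · ε · ‖f‖. -/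

import Mathlib

open scoped RealInnerProductSpace

/-- Number of features at layer `l` of a `D`-layer network with `F₀ = F_D = 1` and
`F_l = F` for `1 ≤ l ≤ D - 1`. -/
def featDim (D F l : ℕ) : ℕ := if l = 0 ∨ l = D then 1 else F

/-- The function `K s = s` on `[-1, 1]` and `K s = 1 / s` elsewhere. -/
noncomputable def truncInv (s : ℝ) : ℝ := s / max 1 (s ^ 2)

/-- The function `K + K'`, with `K = truncInv`. -/
noncomputable def truncInvAddDeriv (s : ℝ) : ℝ := if |s| ≤ 1 then 1 + s else 1 / s - 1 / s ^ 2

theorem truncInv_of_abs_le {s : ℝ} (hs : |s| ≤ 1) : truncInv s = s := by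
  rw [truncInv, max_eq_left ((sq_le_one_iff_abs_le_one s).2 hs), div_one]

theorem truncInv_of_one_le_abs {s : ℝ} (hs : 1 ≤ |s|) : truncInv s = 1 / s := by
  have h0 : s ≠ 0 := by rintro rfl; simp at hs; linarith
  rw [truncInv, max_eq_right ((one_le_sq_iff_one_le_abs s).2 hs)]
  field_simp

theorem continuous_truncInv : Continuous truncInv := by
  unfold truncInv
  exact continuous_id.div (by fun_prop) fun s => (lt_max_of_lt_left one_pos).ne'

theorem abs_truncInv_le (s : ℝ) : |truncInv s| ≤ 1 := by
  rcases le_total |s| 1 with h | h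
  · rwa [truncInv_of_abs_le h]
  · rw [truncInv_of_one_le_abs h, abs_div, abs_one]
    exact (div_le_one (by linarith)).2 h

theorem hasDerivAt_truncInv {s : ℝ} (hs : |s| ≠ 1) :
    HasDerivAt truncInv (truncInvAddDeriv s - truncInv s) s := by
  rcases lt_or_gt_of_ne hs with h | h
  · have : truncInvAddDeriv s - truncInv s = 1 := by
      rw [truncInvAddDeriv, if_pos h.le, truncInv_of_abs_le h.le]; ring
    rw [this]
    refine (hasDerivAt_id s).congr_of_eventuallyEq ?_
    filter_upwards [continuous_abs.continuousAt.eventually_lt_const h] with t ht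
    exact truncInv_of_abs_le ht.le
  · have h0 : s ≠ 0 := by rintro rfl; simp at h; linarith
    have : truncInvAddDeriv s - truncInv s = -(s ^ 2)⁻¹ := by
      rw [truncInvAddDeriv, if_neg (not_le.2 h), truncInv_of_one_le_abs h.le, one_div (s ^ 2)]
      ring
    rw [this]
    refine (hasDerivAt_inv h0).congr_of_eventuallyEq ?_
    filter_upwards [continuous_abs.continuousAt.eventually_const_lt h] with t ht
    rw [truncInv_of_one_le_abs ht.le, one_div]

theorem measurable_truncInvAddDeriv : Measurable truncInvAddDeriv := by
  unfold truncInvAddDeriv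
  exact Measurable.ite (measurableSet_le (by fun_prop) (by fun_prop)) (by fun_prop) (by fun_prop)

open MeasureTheory Set in
theorem integrable_sq_truncInvAddDeriv :
    Integrable (fun s => truncInvAddDeriv s ^ 2) ∧ ∫ s, truncInvAddDeriv s ^ 2 ≤ 8 := by
  have e2 : ∀ s ∈ Ioi (1 : ℝ), s ^ (-2 : ℝ) = 1 / s ^ 2 := fun s hs => by
    rw [Real.rpow_neg (zero_le_one.trans (le_of_lt hs)), one_div]; norm_cast
  have i1 : IntegrableOn (fun s : ℝ => 1 / s ^ 2) (Ioi 1) :=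
    (integrableOn_Ioi_rpow_of_lt (by norm_num : (-2 : ℝ) < -1) one_pos).congr_fun e2
      measurableSet_Ioi
  have v1 : ∫ s in Ioi (1 : ℝ), 1 / s ^ 2 = 1 := by
    rw [← setIntegral_congr_fun measurableSet_Ioi e2,
      integral_Ioi_rpow_of_lt (by norm_num) one_pos]
    norm_num
  have i2 : IntegrableOn (fun s : ℝ => (1 + s) ^ 2) (Ioc (-1) 1) :=
    (by fun_prop : Continuous fun s : ℝ => (1 + s) ^ 2).integrableOn_Ioc
  have v2 : ∫ s in Ioc (-1 : ℝ) 1, (1 + s) ^ 2 = 8 / 3 := by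
    rw [← intervalIntegral.integral_of_le (by norm_num),
      intervalIntegral.integral_comp_add_left (fun s : ℝ => s ^ 2) 1, integral_pow]
    norm_num
  have i3 : IntegrableOn (fun s : ℝ => 4 / s ^ 2) (Iic (-1)) := by
    have h4 : IntegrableOn (fun s : ℝ => 4 * (1 / s ^ 2)) (Ici 1) :=
      (integrableOn_Ici_iff_integrableOn_Ioi (by simp)).2 (i1.const_mul 4)
    rw [← neg_neg (1 : ℝ)] at h4
    have := h4.comp_neg_Iic
    refine this.congr_fun (fun s _ => ?_) measurableSet_Iic
    simp only [even_two, Even.neg_pow]; ring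
  have v3 : ∫ s in Iic (-1 : ℝ), 4 / s ^ 2 = 4 := by
    have := integral_comp_neg_Iic (-1) fun s : ℝ => 4 / s ^ 2
    simp only [even_two, Even.neg_pow, neg_neg] at this
    rw [this]
    have : ∀ s : ℝ, 4 / s ^ 2 = 4 * (1 / s ^ 2) := fun s => by ring
    simp only [this, integral_const_mul, v1, mul_one]
  rw [← integrable_indicator_iff measurableSet_Ioi] at i1
  rw [← integrable_indicator_iff measurableSet_Ioc] at i2
  rw [← integrable_indicator_iff measurableSet_Iic] at i3
  rw [← integral_indicator measurableSet_Ioi] at v1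
  rw [← integral_indicator measurableSet_Ioc] at v2
  rw [← integral_indicator measurableSet_Iic] at v3
  have hle : ∀ s, truncInvAddDeriv s ^ 2 ≤ (Ioi (1 : ℝ)).indicator (fun s => 1 / s ^ 2) s +
      (Ioc (-1 : ℝ) 1).indicator (fun s => (1 + s) ^ 2) s +
      (Iic (-1 : ℝ)).indicator (fun s => 4 / s ^ 2) s := fun s => by
    rcases lt_or_ge 1 s with h | h
    · have h1 : ¬ |s| ≤ 1 := fun h' => absurd ((le_abs_self s).trans h') (not_le.2 h)
      have h2 : ¬ s ≤ -1 := by linarith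
      simp only [indicator, mem_Ioi, mem_Ioc, mem_Iic, h, not_le.2 h, h2, if_true, if_false,
        and_false, add_zero, truncInvAddDeriv, h1]
      have h3 : 0 < 1 / s := by positivity
      have h4 : 1 / s ≤ 1 := (div_le_one (by linarith)).2 h.le
      rw [← one_div_pow]
      nlinarith [mul_nonneg h3.le (sub_nonneg.2 h4), mul_pos h3 h3]
    · rcases lt_or_ge (-1) s with h' | h'
      · have h1 : |s| ≤ 1 := abs_le.2 ⟨h'.le, h⟩
        simp [indicator, h, h', not_lt.2 h, not_le.2 h', truncInvAddDeriv, h1]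
      · simp only [indicator, mem_Ioi, mem_Ioc, mem_Iic, not_lt.2 h, not_lt.2 h', h', if_true,
          if_false, false_and, zero_add, truncInvAddDeriv]
        rcases h'.lt_or_eq with h'' | rfl
        · rw [if_neg (by rw [abs_of_neg (by linarith)]; linarith)]
          have h3 : 1 / s < 0 := one_div_neg.2 (by linarith)
          have h4 : -1 ≤ 1 / s := by
            rw [le_div_iff_of_neg (by linarith)]; linarith
          rw [show 4 / s ^ 2 = 4 * (1 / s) ^ 2 by ring, ← one_div_pow]
          have h5 : (1 / s - (1 / s) ^ 2) = (1 / s) * (1 - 1 / s) := by ring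
          rw [h5, mul_pow, mul_comm]
          exact mul_le_mul_of_nonneg_right (by nlinarith) (sq_nonneg _)
        · norm_num
  have hsum := (i1.add i2).add i3
  have hint : Integrable (fun s => truncInvAddDeriv s ^ 2) :=
    hsum.mono' (measurable_truncInvAddDeriv.pow_const 2).aestronglyMeasurable
      (ae_of_all _ fun s => by rw [Real.norm_of_nonneg (sq_nonneg _)]; exact hle s)
  refine ⟨hint, (integral_mono hint hsum hle).trans ?_⟩
  rw [integral_add' (i1.add i2) i3, integral_add' i1 i2, v1, v2, v3]
  norm_num

open MeasureTheory Set in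
theorem integrable_sq_indicator_exp_neg :
    Integrable (fun s => ((Ioi (0 : ℝ)).indicator (fun t => Real.exp (-t)) s) ^ 2) ∧
      ∫ s, ((Ioi (0 : ℝ)).indicator (fun t => Real.exp (-t)) s) ^ 2 = 1 / 2 := by
  have h : (fun s => ((Ioi (0 : ℝ)).indicator (fun t => Real.exp (-t)) s) ^ 2)
      = (Ioi (0 : ℝ)).indicator fun t => Real.exp (-2 * t) := by
    ext s
    by_cases hs : s ∈ Ioi (0 : ℝ)
    · simp only [indicator_of_mem hs, ← Real.exp_nat_mul]
      congr 1; push_cast; ring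
    · simp [indicator_of_notMem hs]
  rw [h, integrable_indicator_iff measurableSet_Ioi, integral_indicator measurableSet_Ioi,
    integral_exp_mul_Ioi (by norm_num)]
  exact ⟨integrableOn_exp_mul_Ioi (by norm_num) _, by norm_num⟩

open MeasureTheory Set Filter Topology in
theorem integral_truncInvAddDeriv_mul_exp (x : ℝ) :
    ∫ t, truncInvAddDeriv (x - t) * (Ioi (0 : ℝ)).indicator (fun t => Real.exp (-t)) t
      = truncInv x := by
  have hp : MemLp (fun t => truncInvAddDeriv (x - t)) 2 :=
    ((memLp_two_iff_integrable_sq measurable_truncInvAddDeriv.aestronglyMeasurable).2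
      integrable_sq_truncInvAddDeriv.1).comp_measurePreserving (volume.measurePreserving_sub_left x)
  have hq : MemLp ((Ioi (0 : ℝ)).indicator fun t => Real.exp (-t)) 2 :=
    (memLp_two_iff_integrable_sq ((by fun_prop : Measurable fun t : ℝ => Real.exp (-t)).indicator
      measurableSet_Ioi).aestronglyMeasurable).2 integrable_sq_indicator_exp_neg.1
  have hint := hp.integrable_mul hq
  have hfun : (fun t => truncInvAddDeriv (x - t) *
      (Ioi (0 : ℝ)).indicator (fun t => Real.exp (-t)) t)
      = (Ioi (0 : ℝ)).indicator fun t => truncInvAddDeriv (x - t) * Real.exp (-t) := by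
    ext t
    by_cases ht : t ∈ Ioi (0 : ℝ) <;> simp [indicator, ht]
  have hint' : IntegrableOn (fun t => truncInvAddDeriv (x - t) * Real.exp (-t)) (Ioi 0) := by
    rw [← integrable_indicator_iff measurableSet_Ioi, ← hfun]; exact hint
  rw [hfun, integral_indicator measurableSet_Ioi]
  refine tendsto_nhds_unique (intervalIntegral_tendsto_integral_Ioi 0 hint' tendsto_id) ?_
  have hftc : ∀ R : ℝ, 0 ≤ R → ∫ t in (0 : ℝ)..R, truncInvAddDeriv (x - t) * Real.exp (-t)
      = truncInv x - truncInv (x - R) * Real.exp (-R) := fun R hR => by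
    rw [integral_eq_of_hasDerivAt_off_countable_of_le
      (fun t => -(truncInv (x - t) * Real.exp (-t))) _ hR (s := {x - 1, x + 1})
      (by simp) ?_ ?_ ?_]
    · simp; ring
    · exact Continuous.continuousOn
        (((continuous_truncInv.comp (by fun_prop)).mul (by fun_prop)).neg)
    · rintro t ⟨-, ht⟩
      have ht' : |x - t| ≠ 1 := fun h => ht <| by
        rcases (abs_eq zero_le_one).1 h with h | h
        · left; linarith
        · right; simp; linarith
      have h1 := (hasDerivAt_truncInv ht').comp t ((hasDerivAt_id t).const_sub x)
      have h2 := (h1.mul (hasDerivAt_neg t).exp).neg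
      refine h2.congr_deriv ?_
      simp only [Function.comp_apply]
      ring
    · rw [intervalIntegrable_iff_integrableOn_Ioc_of_le hR]
      exact hint'.mono_set Ioc_subset_Ioi_self
  have hlim : Tendsto (fun R : ℝ => truncInv (x - R) * Real.exp (-R)) atTop (𝓝 0) := by
    refine squeeze_zero_norm (fun R => ?_) (Real.tendsto_exp_neg_atTop_nhds_zero)
    rw [norm_mul, Real.norm_of_nonneg (Real.exp_pos _).le]
    exact mul_le_of_le_one_left (Real.exp_pos _).le (abs_truncInv_le _)
  have := (tendsto_const_nhds (x := truncInv x)).sub hlim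
  rw [sub_zero] at this
  refine this.congr' ?_
  filter_upwards [eventually_ge_atTop 0] with R hR
  exact (hftc R hR).symm

open MeasureTheory in
/-- A Schur multiplier in Gram form `∫ a i * b j`, with `‖a i‖₂², ‖b j‖₂² ≤ C`, increases the norm
of a bilinear form by a factor at most `C`. -/
theorem sum_mul_integral_mul_le {ι : Type*} [Fintype ι] (M : ι → ι → ℝ) (ε C : ℝ) (hε : 0 ≤ ε)
    (hM : ∀ u v : ι → ℝ, ∑ i, ∑ j, u i * M i j * v j ≤ ε / 2 * (∑ i, u i ^ 2 + ∑ j, v j ^ 2))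
    (a b : ι → ℝ → ℝ) (ha : ∀ i, MemLp (a i) 2) (hb : ∀ i, MemLp (b i) 2)
    (ha' : ∀ i, ∫ t, a i t ^ 2 ≤ C) (hb' : ∀ i, ∫ t, b i t ^ 2 ≤ C) (u v : ι → ℝ) :
    ∑ i, ∑ j, u i * (M i j * ∫ t, a i t * b j t) * v j
      ≤ ε * C / 2 * (∑ i, u i ^ 2 + ∑ j, v j ^ 2) := by
  have hab : ∀ i j, Integrable (fun t => a i t * b j t) := fun i j => (ha i).integrable_mul (hb j)
  have h1 : ∑ i, ∑ j, u i * (M i j * ∫ t, a i t * b j t) * v j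
      = ∫ t, ∑ i, ∑ j, (u i * a i t) * M i j * (v j * b j t) := by
    rw [integral_finsetSum]
    · refine Finset.sum_congr rfl fun i _ => ?_
      rw [integral_finsetSum]
      · refine Finset.sum_congr rfl fun j _ => ?_
        rw [show (fun t => (u i * a i t) * M i j * (v j * b j t))
          = fun t => (u i * M i j * v j) * (a i t * b j t) by ext; ring, integral_const_mul]
        ring
      · intro j _
        rw [show (fun t => (u i * a i t) * M i j * (v j * b j t))
          = fun t => (u i * M i j * v j) * (a i t * b j t) by ext; ring]
        exact (hab i j).const_mul _
    · intro i _
      refine integrable_finsetSum _ fun j _ => ?_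
      rw [show (fun t => (u i * a i t) * M i j * (v j * b j t))
          = fun t => (u i * M i j * v j) * (a i t * b j t) by ext; ring]
      exact (hab i j).const_mul _
  have hia : ∀ i, Integrable (fun t => (u i * a i t) ^ 2) := fun i => by
    simpa only [mul_pow] using (ha i).integrable_sq.const_mul (u i ^ 2)
  have hib : ∀ i, Integrable (fun t => (v i * b i t) ^ 2) := fun i => by
    simpa only [mul_pow] using (hb i).integrable_sq.const_mul (v i ^ 2)
  have hsa : ∫ t, ∑ i, (u i * a i t) ^ 2 ≤ C * ∑ i, u i ^ 2 := by
    rw [integral_finsetSum _ fun i _ => hia i, Finset.mul_sum]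
    refine Finset.sum_le_sum fun i _ => ?_
    simp only [mul_pow, integral_const_mul]
    rw [mul_comm]
    exact mul_le_mul_of_nonneg_right (ha' i) (sq_nonneg _)
  have hsb : ∫ t, ∑ i, (v i * b i t) ^ 2 ≤ C * ∑ i, v i ^ 2 := by
    rw [integral_finsetSum _ fun i _ => hib i, Finset.mul_sum]
    refine Finset.sum_le_sum fun i _ => ?_
    simp only [mul_pow, integral_const_mul]
    rw [mul_comm]
    exact mul_le_mul_of_nonneg_right (hb' i) (sq_nonneg _)
  have hA := integrable_finsetSum Finset.univ fun i _ => hia i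
  have hB := integrable_finsetSum Finset.univ fun i _ => hib i
  rw [h1]
  calc _ ≤ ∫ t, ε / 2 * (∑ i, (u i * a i t) ^ 2 + ∑ j, (v j * b j t) ^ 2) := by
        refine integral_mono ?_ ((hA.add hB).const_mul _) fun t => hM _ _
        refine integrable_finsetSum _ fun i _ => integrable_finsetSum _ fun j _ => ?_
        rw [show (fun t => (u i * a i t) * M i j * (v j * b j t))
          = fun t => (u i * M i j * v j) * (a i t * b j t) by ext; ring]
        exact (hab i j).const_mul _
    _ = ε / 2 * (∫ t, ∑ i, (u i * a i t) ^ 2) + ε / 2 * ∫ t, ∑ j, (v j * b j t) ^ 2 := by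
        rw [integral_const_mul, integral_add hA hB, mul_add]
    _ ≤ ε / 2 * (C * ∑ i, u i ^ 2) + ε / 2 * (C * ∑ i, v i ^ 2) := by gcongr
    _ = _ := by ring

theorem inner_eq_sum_eigenvalue_mul_sq {ι E : Type*} [Fintype ι] [NormedAddCommGroup E]
    [InnerProductSpace ℝ E] {L : E →L[ℝ] E} (hL : ∀ x y : E, ⟪L x, y⟫ = ⟪x, L y⟫) {μ : ι → ℝ}
    (b : OrthonormalBasis ι ℝ E) (hb : ∀ i, L (b i) = μ i • b i) (v : E) :
    ⟪L v, v⟫ = ∑ i, μ i * ⟪b i, v⟫ ^ 2 := by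
  rw [← b.sum_inner_mul_inner]
  refine Finset.sum_congr rfl fun i _ => ?_
  rw [hL, hb, real_inner_smul_right, real_inner_comm]
  ring

/-- Weyl's inequality. -/
theorem eigenvalue_le_add_of_inner_le {E : Type*} [NormedAddCommGroup E] [InnerProductSpace ℝ E]
    {n : ℕ} {L L' : E →L[ℝ] E} (hL : ∀ x y : E, ⟪L x, y⟫ = ⟪x, L y⟫)
    (hL' : ∀ x y : E, ⟪L' x, y⟫ = ⟪x, L' y⟫) {μ μ' : Fin n → ℝ} (hμ : Monotone μ)
    (hμ' : Monotone μ') (b b' : OrthonormalBasis (Fin n) ℝ E) (hb : ∀ i, L (b i) = μ i • b i)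
    (hb' : ∀ i, L' (b' i) = μ' i • b' i) {ε : ℝ}
    (h : ∀ v, ⟪L' v, v⟫ ≤ ⟪L v, v⟫ + ε * ‖v‖ ^ 2) (i : Fin n) : μ' i ≤ μ i + ε := by
  have := b.toBasis.finiteDimensional_of_finite
  let T : E →ₗ[ℝ] (Fin n → ℝ) := LinearMap.pi fun j =>
    if j < i then (innerₛₗ ℝ (b' j)) else if i < j then (innerₛₗ ℝ (b j)) else 0
  have hT : ¬ Function.Injective T := by
    rw [LinearMap.injective_iff_surjective_of_finrank_eq_finrank
      (by simp [Module.finrank_eq_card_basis b.toBasis])]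
    intro hs
    obtain ⟨v, hv⟩ := hs 1
    have := congrFun hv i
    simp [T] at this
  rw [injective_iff_map_eq_zero] at hT
  push Not at hT
  obtain ⟨v, hTv, hv⟩ := hT
  have h1 : ∀ j < i, ⟪b' j, v⟫ = 0 := fun j hj => by
    simpa [T, hj] using congrFun hTv j
  have h2 : ∀ j, i < j → ⟪b j, v⟫ = 0 := fun j hj => by
    simpa [T, hj, hj.not_gt] using congrFun hTv j
  have h3 : ⟪L v, v⟫ ≤ μ i * ‖v‖ ^ 2 := by
    rw [inner_eq_sum_eigenvalue_mul_sq hL b hb, ← b.sum_sq_inner_right v, Finset.mul_sum]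
    refine Finset.sum_le_sum fun j _ => ?_
    rcases le_or_gt j i with hj | hj
    · exact mul_le_mul_of_nonneg_right (hμ hj) (sq_nonneg _)
    · simp [h2 j hj]
  have h4 : μ' i * ‖v‖ ^ 2 ≤ ⟪L' v, v⟫ := by
    rw [inner_eq_sum_eigenvalue_mul_sq hL' b' hb', ← b'.sum_sq_inner_right v, Finset.mul_sum]
    refine Finset.sum_le_sum fun j _ => ?_
    rcases le_or_gt i j with hj | hj
    · exact mul_le_mul_of_nonneg_right (hμ' hj) (sq_nonneg _)
    · simp [h1 j hj]
  have h5 : 0 < ‖v‖ ^ 2 := by positivity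
  refine le_of_mul_le_mul_right ?_ h5
  linarith [h v]

open MeasureTheory Set in
/-- The Schur multiplier `1 / (x i - y j)` on a block where `|x i - y j| ≥ δ` has norm at most
`2 / δ`. -/
theorem sum_div_sub_le {ι : Type*} [Fintype ι] {M : ι → ι → ℝ} {ε δ : ℝ} (hε : 0 ≤ ε) (hδ : 0 < δ)
    (hM : ∀ u v : ι → ℝ, ∑ i, ∑ j, u i * M i j * v j ≤ ε / 2 * (∑ i, u i ^ 2 + ∑ j, v j ^ 2))
    (x y u v : ι → ℝ) (h : ∀ i j, u i ≠ 0 → v j ≠ 0 → δ ≤ |x i - y j|) :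
    ∑ i, ∑ j, u i * (M i j / (x i - y j)) * v j
      ≤ ε / δ * (∑ i, u i ^ 2 + ∑ j, v j ^ 2) := by
  let q : ℝ → ℝ := (Ioi (0 : ℝ)).indicator fun t => Real.exp (-t)
  have hp : MemLp truncInvAddDeriv 2 :=
    (memLp_two_iff_integrable_sq measurable_truncInvAddDeriv.aestronglyMeasurable).2
      integrable_sq_truncInvAddDeriv.1
  have hq : MemLp q 2 :=
    (memLp_two_iff_integrable_sq ((by fun_prop : Measurable fun t : ℝ => Real.exp (-t)).indicator
      measurableSet_Ioi).aestronglyMeasurable).2 integrable_sq_indicator_exp_neg.1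
  have key := sum_mul_integral_mul_le M ε 2 hε hM
    (fun i t => 1 / 2 * truncInvAddDeriv (x i / δ - t)) (fun j t => 2 * q (t - y j / δ))
    (fun i => (hp.comp_measurePreserving (volume.measurePreserving_sub_left _)).const_mul _)
    (fun j => (hq.comp_measurePreserving (measurePreserving_sub_right volume _)).const_mul _)
    (fun i => by
      simp only [mul_pow, integral_const_mul]
      rw [integral_sub_left_eq_self (fun t => truncInvAddDeriv t ^ 2)]
      linarith [integrable_sq_truncInvAddDeriv.2])
    (fun j => by
      simp only [mul_pow, integral_const_mul]
      rw [integral_sub_right_eq_self (fun t => q t ^ 2)]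
      linarith [integrable_sq_indicator_exp_neg.2]) u v
  have hK : ∀ i j, ∫ t, 1 / 2 * truncInvAddDeriv (x i / δ - t) * (2 * q (t - y j / δ))
      = truncInv ((x i - y j) / δ) := fun i j => by
    rw [← integral_truncInvAddDeriv_mul_exp,
      ← integral_sub_right_eq_self (fun t => truncInvAddDeriv ((x i - y j) / δ - t) * q t)
        (y j / δ)]
    refine integral_congr_ae (ae_of_all _ fun t => ?_)
    simp only [q]
    rw [show (x i - y j) / δ - (t - y j / δ) = x i / δ - t by ring]
    ring
  simp only [hK] at key
  have heq : ∑ i, ∑ j, u i * (M i j * truncInv ((x i - y j) / δ)) * v j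
      = δ * ∑ i, ∑ j, u i * (M i j / (x i - y j)) * v j := by
    simp only [Finset.mul_sum]
    refine Finset.sum_congr rfl fun i _ => Finset.sum_congr rfl fun j _ => ?_
    by_cases hu : u i = 0
    · simp [hu]
    by_cases hv : v j = 0
    · simp [hv]
    have := h i j hu hv
    rw [truncInv_of_one_le_abs (by rwa [abs_div, abs_of_pos hδ, one_le_div hδ]), one_div_div]
    ring
  rw [heq] at key
  rw [div_mul_eq_mul_div, le_div_iff₀ hδ]
  linarith

/-- A Davis–Kahan type estimate for the difference of two spectral projections. -/
theorem sum_projection_sub_le {ι κ : Type*} [Fintype ι] [DecidableEq κ] {G : ι → ι → ℝ}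
    {x y : ι → ℝ} {ε δ : ℝ} (hε : 0 ≤ ε) (hδ : 0 < δ)
    (hM : ∀ u v : ι → ℝ, ∑ i, ∑ j, u i * (G i j * (x i - y j)) * v j
      ≤ ε / 2 * (∑ i, u i ^ 2 + ∑ j, v j ^ 2))
    (part : ι → κ) (hsep : ∀ i j, part i ≠ part j → δ ≤ |x i - y j|) (k : κ) {c : ℝ} (hc : |c| ≤ 1)
    (u v : ι → ℝ) :
    ∑ i, ∑ j, u i * (G i j * ((if part i = k then c else 0) - if part j = k then c else 0)) * v j
      ≤ ε / δ * (∑ i, u i ^ 2 + ∑ j, v j ^ 2) := by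
  have hc2 : c ^ 2 ≤ 1 := (sq_le_one_iff_abs_le_one c).2 hc
  have h1 := sum_div_sub_le hε hδ hM x y (fun i => if part i = k then c * u i else 0)
    (fun j => if part j = k then 0 else v j) fun i j hi hj => hsep i j fun h => by
      by_cases hk : part j = k <;> simp_all
  have h2 := sum_div_sub_le hε hδ hM x y (fun i => if part i = k then 0 else -c * u i)
    (fun j => if part j = k then v j else 0) fun i j hi hj => hsep i j fun h => by
      by_cases hk : part j = k <;> simp_all
  calc _ = (∑ i, ∑ j, (if part i = k then c * u i else 0) * (G i j * (x i - y j) / (x i - y j)) *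
            (if part j = k then 0 else v j))
        + ∑ i, ∑ j, (if part i = k then 0 else -c * u i) * (G i j * (x i - y j) / (x i - y j)) *
            (if part j = k then v j else 0) := by
        simp only [← Finset.sum_add_distrib]
        refine Finset.sum_congr rfl fun i _ => Finset.sum_congr rfl fun j _ => ?_
        by_cases hij : part i = part j
        · by_cases hk : part j = k <;> simp [hij, hk]
        · have h0 : x i - y j ≠ 0 := fun h0 => by
            have := hsep i j hij
            rw [h0, abs_zero] at this
            linarith
          rw [mul_div_cancel_right₀ _ h0]
          by_cases hi : part i = k <;> by_cases hj : part j = k <;>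
            simp only [hi, hj, if_true, if_false] <;> ring
    _ ≤ _ := add_le_add h1 h2
    _ = ε / δ * (∑ i, ((if part i = k then c * u i else 0) ^ 2
            + (if part i = k then 0 else -c * u i) ^ 2)
          + ∑ j, ((if part j = k then 0 else v j) ^ 2 + (if part j = k then v j else 0) ^ 2)) := by
        simp only [Finset.sum_add_distrib]; ring
    _ ≤ _ := by
        refine mul_le_mul_of_nonneg_left (add_le_add (Finset.sum_le_sum fun i _ => ?_)
          (Finset.sum_le_sum fun j _ => ?_)) (by positivity)
        · have : c ^ 2 * u i ^ 2 ≤ u i ^ 2 := mul_le_of_le_one_left (sq_nonneg _) hc2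
          split_ifs <;> nlinarith
        · split_ifs <;> simp

theorem exists_center_of_abs_sub_le (s : Finset ℝ) {r : ℝ} (hs : ∀ a ∈ s, |a| ≤ 1)
    (hr : ∀ a ∈ s, ∀ b ∈ s, |a - b| ≤ 2 * r) : ∃ c, |c| ≤ 1 ∧ ∀ a ∈ s, |a - c| ≤ r := by
  rcases s.eq_empty_or_nonempty with rfl | hne
  · exact ⟨0, by simp⟩
  have h := abs_le.1 (hr _ (s.max'_mem hne) _ (s.min'_mem hne))
  have h1 := abs_le.1 (hs _ (s.max'_mem hne))
  have h2 := abs_le.1 (hs _ (s.min'_mem hne))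
  refine ⟨(s.max' hne + s.min' hne) / 2, abs_le.2 ⟨by linarith, by linarith⟩, fun a ha => ?_⟩
  have h3 := s.le_max' a ha
  have h4 := s.min'_le a ha
  exact abs_le.2 ⟨by linarith, by linarith⟩

theorem sum_filter_sub_le {ι : Type*} [Fintype ι] {N : ℕ} {G : ι → ι → ℝ}
    {x y : ι → ℝ} {ε δ : ℝ} (hε : 0 < ε) (hδ : 0 < δ)
    (hG : ∀ u v : ι → ℝ, ∑ i, ∑ j, u i * G i j * v j ≤ 1 / 2 * (∑ i, u i ^ 2 + ∑ j, v j ^ 2))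
    (hM : ∀ u v : ι → ℝ, ∑ i, ∑ j, u i * (G i j * (x i - y j)) * v j
      ≤ ε / 2 * (∑ i, u i ^ 2 + ∑ j, v j ^ 2))
    (part : ι → Fin N) (hsep : ∀ i j, part i ≠ part j → δ ≤ |x i - y j|) {h : ℝ → ℝ}
    (hbd : ∀ t, |h t| ≤ 1)
    (hvar : ∀ i j, part i = part j → |h (x i) - h (x j)| ≤ Real.pi * ε / (2 * δ) ∧
      |h (x i) - h (y j)| ≤ Real.pi * ε / (2 * δ) ∧ |h (y i) - h (y j)| ≤ Real.pi * ε / (2 * δ))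
    (u v : ι → ℝ) :
    ∑ i, ∑ j, u i * (G i j * (h (x i) - h (y j))) * v j
      ≤ N * Real.pi * ε / δ / 2 * (∑ i, u i ^ 2 + ∑ j, v j ^ 2) := by
  classical
  rcases isEmpty_or_nonempty ι with hι | ⟨⟨i₀⟩⟩
  · simp
  obtain ⟨r, hr⟩ : ∃ r, r = Real.pi * ε / (4 * δ) := ⟨_, rfl⟩
  have hr0 : 0 < r := by rw [hr]; positivity
  have h2r : Real.pi * ε / (2 * δ) = 2 * r := by rw [hr]; field_simp; norm_num
  rw [h2r] at hvar
  have hcen : ∀ k : Fin N, ∃ c, |c| ≤ 1 ∧ ∀ i, part i = k → |h (x i) - c| ≤ r ∧ |h (y i) - c| ≤ r := by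
    intro k
    obtain ⟨c, hc1, hc⟩ := exists_center_of_abs_sub_le
      ((Finset.univ.filter (part · = k)).image (fun i => h (x i)) ∪
        (Finset.univ.filter (part · = k)).image (fun i => h (y i))) (r := r)
      (by
        simp only [Finset.mem_union, Finset.mem_image]
        rintro a (⟨i, -, rfl⟩ | ⟨i, -, rfl⟩) <;> exact hbd _)
      (by
        simp only [Finset.mem_union, Finset.mem_image, Finset.mem_filter, Finset.mem_univ,
          true_and]
        rintro a (⟨i, hi, rfl⟩ | ⟨i, hi, rfl⟩) b (⟨j, hj, rfl⟩ | ⟨j, hj, rfl⟩)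
        · exact (hvar i j (hi.trans hj.symm)).1
        · exact (hvar i j (hi.trans hj.symm)).2.1
        · rw [abs_sub_comm]; exact (hvar j i (hj.trans hi.symm)).2.1
        · exact (hvar i j (hi.trans hj.symm)).2.2)
    refine ⟨c, hc1, fun i hi => ⟨hc _ ?_, hc _ ?_⟩⟩
    · exact Finset.mem_union_left _ (Finset.mem_image.2 ⟨i, by simpa using hi, rfl⟩)
    · exact Finset.mem_union_right _ (Finset.mem_image.2 ⟨i, by simpa using hi, rfl⟩)
  choose c hc1 hc using hcen
  have hsq : ∀ (w : ι → ℝ) (d : ι → ℝ), (∀ i, |d i| ≤ r) →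
      ∑ i, (d i / r * w i) ^ 2 ≤ ∑ i, w i ^ 2 := fun w d hd =>
    Finset.sum_le_sum fun i _ => by
      rw [mul_pow]
      refine mul_le_of_le_one_left (sq_nonneg _) ((sq_le_one_iff_abs_le_one _).2 ?_)
      rw [abs_div, abs_of_pos hr0]
      exact (div_le_one hr0).2 (hd i)
  have hdx : ∑ i, ∑ j, u i * (G i j * (h (x i) - c (part i))) * v j
      ≤ r / 2 * (∑ i, u i ^ 2 + ∑ j, v j ^ 2) := by
    have h1 := hG (fun i => (h (x i) - c (part i)) / r * u i) v
    have h2 := hsq u (fun i => h (x i) - c (part i)) fun i => (hc _ i rfl).1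
    have h3 : ∑ i, ∑ j, u i * (G i j * (h (x i) - c (part i))) * v j
        = r * ∑ i, ∑ j, (h (x i) - c (part i)) / r * u i * G i j * v j := by
      simp only [Finset.mul_sum]
      refine Finset.sum_congr rfl fun i _ => Finset.sum_congr rfl fun j _ => ?_
      field_simp
    rw [h3]
    nlinarith
  have hdy : ∑ i, ∑ j, u i * (G i j * (c (part j) - h (y j))) * v j
      ≤ r / 2 * (∑ i, u i ^ 2 + ∑ j, v j ^ 2) := by
    have h1 := hG u (fun j => (c (part j) - h (y j)) / r * v j)
    have h2 := hsq v (fun j => c (part j) - h (y j)) fun j => by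
      rw [abs_sub_comm]; exact (hc _ j rfl).2
    have h3 : ∑ i, ∑ j, u i * (G i j * (c (part j) - h (y j))) * v j
        = r * ∑ i, ∑ j, u i * G i j * ((c (part j) - h (y j)) / r * v j) := by
      simp only [Finset.mul_sum]
      refine Finset.sum_congr rfl fun i _ => Finset.sum_congr rfl fun j _ => ?_
      field_simp
    rw [h3]
    nlinarith
  have hsplit : ∑ i, ∑ j, u i * (G i j * (h (x i) - h (y j))) * v j
      = ∑ i, ∑ j, u i * (G i j * (c (part i) - c (part j))) * v j
        + ∑ i, ∑ j, u i * (G i j * (h (x i) - c (part i))) * v j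
        + ∑ i, ∑ j, u i * (G i j * (c (part j) - h (y j))) * v j := by
    simp only [← Finset.sum_add_distrib]
    refine Finset.sum_congr rfl fun i _ => Finset.sum_congr rfl fun j _ => ?_
    ring
  have hS : 0 ≤ ∑ i, u i ^ 2 + ∑ j, v j ^ 2 := by positivity
  have hpi := Real.pi_gt_three
  have ht : 0 < ε / δ := by positivity
  have hrt : r = Real.pi / 4 * (ε / δ) := by rw [hr]; field_simp
  have hN : 1 ≤ N := by
    have := (part i₀).isLt
    omega
  rcases hN.eq_or_lt with rfl | hN
  · have hzero : ∑ i, ∑ j, u i * (G i j * (c (part i) - c (part j))) * v j = 0 :=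
      Finset.sum_eq_zero fun i _ => Finset.sum_eq_zero fun j _ => by
        rw [Subsingleton.elim (part i) (part j)]; ring
    have hfin : r ≤ (1 : ℕ) * Real.pi * ε / δ / 2 := by
      rw [hrt, mul_div_assoc]
      push_cast
      nlinarith
    have := mul_le_mul_of_nonneg_right hfin hS
    linarith
  · have hproj : ∑ i, ∑ j, u i * (G i j * (c (part i) - c (part j))) * v j
        ≤ N * (ε / δ * (∑ i, u i ^ 2 + ∑ j, v j ^ 2)) := by
      calc _ = ∑ k : Fin N, ∑ i, ∑ j, u i * (G i j *
            ((if part i = k then c k else 0) - if part j = k then c k else 0)) * v j := by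
            symm
            rw [Finset.sum_comm]
            refine Finset.sum_congr rfl fun i _ => ?_
            rw [Finset.sum_comm]
            refine Finset.sum_congr rfl fun j _ => ?_
            rw [← Finset.sum_mul, ← Finset.mul_sum, ← Finset.mul_sum, Finset.sum_sub_distrib]
            simp
        _ ≤ ∑ _k : Fin N, ε / δ * (∑ i, u i ^ 2 + ∑ j, v j ^ 2) :=
            Finset.sum_le_sum fun k _ =>
              sum_projection_sub_le hε.le hδ hM part hsep k (hc1 k) u v
        _ = _ := by simp
    have hN' : (2 : ℝ) ≤ N := by exact_mod_cast hN
    have hfin : N * (ε / δ) + r ≤ N * Real.pi * ε / δ / 2 := by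
      rw [hrt, mul_div_assoc]
      have : (N : ℝ) + Real.pi / 4 ≤ N * Real.pi / 2 := by nlinarith
      nlinarith
    have := mul_le_mul_of_nonneg_right hfin hS
    linarith

/-- The filter `h(T)`, for `T` with orthonormal eigenbasis `b` and eigenvalues `μ`. -/
noncomputable def spectralFilter {ι E : Type*} [Fintype ι] [NormedAddCommGroup E]
    [InnerProductSpace ℝ E] (b : OrthonormalBasis ι ℝ E) (μ : ι → ℝ) (h : ℝ → ℝ) (v : E) : E :=
  ∑ i, (h (μ i) * ⟪v, b i⟫) • b i

section
variable {ι E : Type*} [Fintype ι] [NormedAddCommGroup E] [InnerProductSpace ℝ E]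

theorem spectralFilter_sub (b : OrthonormalBasis ι ℝ E) (μ : ι → ℝ) (h : ℝ → ℝ) (v w : E) :
    spectralFilter b μ h (v - w) = spectralFilter b μ h v - spectralFilter b μ h w := by
  simp [spectralFilter, inner_sub_left, mul_sub, sub_smul]

theorem OrthonormalBasis.norm_sq_sum_smul (b : OrthonormalBasis ι ℝ E) (u : ι → ℝ) :
    ‖∑ i, u i • b i‖ ^ 2 = ∑ i, u i ^ 2 := by
  rw [← real_inner_self_eq_norm_sq, b.orthonormal.inner_sum]
  simp [sq]

theorem norm_spectralFilter_le (b : OrthonormalBasis ι ℝ E) (μ : ι → ℝ) {h : ℝ → ℝ}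
    (hbd : ∀ t, |h t| ≤ 1) (v : E) : ‖spectralFilter b μ h v‖ ≤ ‖v‖ := by
  refine le_of_sq_le_sq ?_ (norm_nonneg _)
  rw [spectralFilter, b.norm_sq_sum_smul, ← b.sum_sq_inner_left v]
  refine Finset.sum_le_sum fun i _ => ?_
  rw [mul_pow]
  exact mul_le_of_le_one_left (sq_nonneg _) ((sq_le_one_iff_abs_le_one _).2 (hbd _))

theorem sum_inner_apply_le (b b' : OrthonormalBasis ι ℝ E) {T : E →L[ℝ] E} {ε : ℝ}
    (hT : ‖T‖ ≤ ε) (u v : ι → ℝ) :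
    ∑ i, ∑ j, u i * ⟪b i, T (b' j)⟫ * v j ≤ ε / 2 * (∑ i, u i ^ 2 + ∑ j, v j ^ 2) := by
  have h1 : ∑ i, ∑ j, u i * ⟪b i, T (b' j)⟫ * v j
      = ⟪∑ i, u i • b i, T (∑ j, v j • b' j)⟫ := by
    simp only [map_sum, map_smul, sum_inner, inner_sum, real_inner_smul_left,
      real_inner_smul_right]
    rw [Finset.sum_comm]
    refine Finset.sum_congr rfl fun i _ => Finset.sum_congr rfl fun j _ => ?_
    ring
  rw [h1, ← b.norm_sq_sum_smul, ← b'.norm_sq_sum_smul]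
  set U := ∑ i, u i • b i
  set V := ∑ j, v j • b' j
  have h2 := (real_inner_le_norm U (T V)).trans
    (mul_le_mul_of_nonneg_left (T.le_of_opNorm_le hT V) (norm_nonneg U))
  have hε := (norm_nonneg T).trans hT
  nlinarith [mul_nonneg hε (sq_nonneg (‖U‖ - ‖V‖))]

theorem inner_spectralFilter_sub (b b' : OrthonormalBasis ι ℝ E) (μ μ' : ι → ℝ) (h : ℝ → ℝ)
    (u v : E) : ⟪u, spectralFilter b μ h v - spectralFilter b' μ' h v⟫
      = ∑ i, ∑ j, ⟪u, b i⟫ * (⟪b i, b' j⟫ * (h (μ i) - h (μ' j))) * ⟪b' j, v⟫ := by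
  have h1 : ⟪u, spectralFilter b μ h v⟫
      = ∑ i, ∑ j, ⟪u, b i⟫ * (⟪b i, b' j⟫ * h (μ i)) * ⟪b' j, v⟫ := by
    simp only [spectralFilter, inner_sum, real_inner_smul_right]
    refine Finset.sum_congr rfl fun i _ => ?_
    rw [real_inner_comm, ← b'.sum_inner_mul_inner, Finset.mul_sum, Finset.sum_mul]
    refine Finset.sum_congr rfl fun j _ => ?_
    ring
  have h2 : ⟪u, spectralFilter b' μ' h v⟫
      = ∑ i, ∑ j, ⟪u, b i⟫ * (⟪b i, b' j⟫ * h (μ' j)) * ⟪b' j, v⟫ := by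
    simp only [spectralFilter, inner_sum, real_inner_smul_right]
    rw [Finset.sum_comm]
    refine Finset.sum_congr rfl fun j _ => ?_
    rw [← b.sum_inner_mul_inner u, Finset.mul_sum, real_inner_comm]
    refine Finset.sum_congr rfl fun i _ => ?_
    ring
  rw [inner_sub_right, h1, h2]
  simp only [← Finset.sum_sub_distrib]
  refine Finset.sum_congr rfl fun i _ => Finset.sum_congr rfl fun j _ => ?_
  ring

theorem norm_le_of_forall_inner_le {v w : E} {c : ℝ} (hv : v = 0 → w = 0)
    (h : ∀ u, ⟪u, w⟫ ≤ c / 2 * (‖u‖ ^ 2 + ‖v‖ ^ 2)) : ‖w‖ ≤ c * ‖v‖ := by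
  by_cases hv0 : v = 0
  · simp [hv hv0, hv0]
  by_cases hw0 : w = 0
  · have := h 0
    have h1 : 0 < ‖v‖ := norm_pos_iff.2 hv0
    simp only [hw0, inner_zero_left, norm_zero] at this ⊢
    nlinarith [sq_nonneg ‖v‖]
  have h1 : 0 < ‖v‖ := norm_pos_iff.2 hv0
  have h2 : 0 < ‖w‖ := norm_pos_iff.2 hw0
  have h3 := h ((‖v‖ / ‖w‖) • w)
  rw [real_inner_smul_left, real_inner_self_eq_norm_sq, norm_smul, norm_div, norm_norm, norm_norm,
    div_mul_cancel₀ _ h2.ne', sq ‖w‖, ← mul_assoc, div_mul_cancel₀ _ h2.ne'] at h3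
  nlinarith

end

/-- Stability of a single filter. -/
theorem norm_spectralFilter_sub_le {E : Type*} [NormedAddCommGroup E] [InnerProductSpace ℝ E]
    {n N : ℕ} {L A : E →L[ℝ] E} (hL : ∀ x y : E, ⟪L x, y⟫ = ⟪x, L y⟫) {ε δ : ℝ} (hε : 0 < ε)
    (hδ : 0 < δ) (hA : ‖A‖ ≤ ε) {μ μ' : Fin n → ℝ} {b b' : OrthonormalBasis (Fin n) ℝ E}
    (hb : ∀ i, L (b i) = μ i • b i) (hb' : ∀ i, (L + A) (b' i) = μ' i • b' i)
    (part : Fin n → Fin N) (hsep : ∀ i j, part i ≠ part j → δ ≤ |μ i - μ' j|) {h : ℝ → ℝ}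
    (hbd : ∀ t, |h t| ≤ 1)
    (hvar : ∀ i j, part i = part j → |h (μ i) - h (μ j)| ≤ Real.pi * ε / (2 * δ) ∧
      |h (μ i) - h (μ' j)| ≤ Real.pi * ε / (2 * δ) ∧ |h (μ' i) - h (μ' j)| ≤ Real.pi * ε / (2 * δ))
    (v : E) : ‖spectralFilter b μ h v - spectralFilter b' μ' h v‖ ≤ N * Real.pi * ε / δ * ‖v‖ := by
  refine norm_le_of_forall_inner_le (fun hv => by simp [hv, spectralFilter]) fun u => ?_
  rw [inner_spectralFilter_sub, ← b.sum_sq_inner_left u, ← b'.sum_sq_inner_right v]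
  refine sum_filter_sub_le (G := fun i j => ⟪b i, b' j⟫) hε hδ
    (sum_inner_apply_le b b' (T := ContinuousLinearMap.id ℝ E) ContinuousLinearMap.norm_id_le)
    (fun u v => ?_) part hsep hbd hvar (fun i => ⟪u, b i⟫) (fun j => ⟪b' j, v⟫)
  have hM : ∀ i j, ⟪b i, b' j⟫ * (μ i - μ' j) = ⟪b i, (-A) (b' j)⟫ := fun i j => by
    have h1 : A (b' j) = μ' j • b' j - L (b' j) := by rw [← hb' j]; simp
    rw [neg_apply, h1, inner_neg_right, inner_sub_right, ← hL, hb,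
      real_inner_smul_left, real_inner_smul_right]
    ring
  simpa only [hM] using sum_inner_apply_le b b' (T := -A) (by rwa [norm_neg]) u v

theorem abs_eigenvalue_sub_le {E : Type*} [NormedAddCommGroup E] [InnerProductSpace ℝ E]
    {n : ℕ} {L A : E →L[ℝ] E} (hL : ∀ x y : E, ⟪L x, y⟫ = ⟪x, L y⟫)
    (hA : ∀ x y : E, ⟪A x, y⟫ = ⟪x, A y⟫) {μ μ' : Fin n → ℝ} (hμ : Monotone μ)
    (hμ' : Monotone μ') (b b' : OrthonormalBasis (Fin n) ℝ E) (hb : ∀ i, L (b i) = μ i • b i)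
    (hb' : ∀ i, (L + A) (b' i) = μ' i • b' i) (i : Fin n) : |μ' i - μ i| ≤ ‖A‖ := by
  have hLA : ∀ x y : E, ⟪(L + A) x, y⟫ = ⟪x, (L + A) y⟫ := fun x y => by
    simp [inner_add_left, inner_add_right, hL, hA]
  have hq : ∀ v, |⟪A v, v⟫| ≤ ‖A‖ * ‖v‖ ^ 2 := fun v => by
    refine (abs_real_inner_le_norm _ _).trans ?_
    rw [sq, ← mul_assoc]
    exact mul_le_mul_of_nonneg_right (A.le_opNorm v) (norm_nonneg v)
  have h1 := eigenvalue_le_add_of_inner_le hL hLA hμ hμ' b b' hb hb' (ε := ‖A‖) (fun v => by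
    rw [add_apply, inner_add_left]
    linarith [(abs_le.1 (hq v)).2]) i
  have h2 := eigenvalue_le_add_of_inner_le hLA hL hμ' hμ b' b hb' hb (ε := ‖A‖) (fun v => by
    rw [add_apply, inner_add_left]
    linarith [(abs_le.1 (hq v)).1]) i
  exact abs_le.2 ⟨by linarith, by linarith⟩

/-- Propagation of a filter perturbation through the layers of a network. -/
theorem norm_network_sub_le {E : Type*} [NormedAddCommGroup E] {D F : ℕ} {c : ℝ}
    (H H' : ℕ → ℕ → ℕ → E → E)
    (hH : ∀ l p q, 1 ≤ l → l ≤ D → p < featDim D F l → q < featDim D F (l - 1) →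
      ∀ v w, ‖H l p q v - H l p q w‖ ≤ ‖v - w‖)
    (hH' : ∀ l p q, 1 ≤ l → l ≤ D → p < featDim D F l → q < featDim D F (l - 1) →
      ∀ v, ‖H' l p q v‖ ≤ ‖v‖)
    (hHH' : ∀ l p q, 1 ≤ l → l ≤ D → p < featDim D F l → q < featDim D F (l - 1) →
      ∀ v, ‖H l p q v - H' l p q v‖ ≤ c * ‖v‖)
    (σ : E → E) (hσ : ∀ a b : E, ‖σ a - σ b‖ ≤ ‖a - b‖) (hσ0 : σ 0 = 0)
    (feat feat' : ℕ → ℕ → E) (h₀ : feat 0 0 = feat' 0 0)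
    (hrec : ∀ l, 1 ≤ l → l ≤ D → ∀ p < featDim D F l,
      feat l p = σ (∑ q ∈ Finset.range (featDim D F (l - 1)), H l p q (feat (l - 1) q)))
    (hrec' : ∀ l, 1 ≤ l → l ≤ D → ∀ p < featDim D F l,
      feat' l p = σ (∑ q ∈ Finset.range (featDim D F (l - 1)), H' l p q (feat' (l - 1) q)))
    (hc : 0 ≤ c) (l : ℕ) (hl : 1 ≤ l) : l ≤ D → ∀ p < featDim D F l,
      ‖feat' l p‖ ≤ F ^ (l - 1) * ‖feat' 0 0‖ ∧
      ‖feat l p - feat' l p‖ ≤ l * F ^ (l - 1) * c * ‖feat' 0 0‖ := by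
  have step : ∀ l, 1 ≤ l → l ≤ D → ∀ p < featDim D F l, ∀ s d : ℝ,
      (∀ q < featDim D F (l - 1), ‖feat' (l - 1) q‖ ≤ s ∧ ‖feat (l - 1) q - feat' (l - 1) q‖ ≤ d) →
      ‖feat' l p‖ ≤ featDim D F (l - 1) * s ∧
        ‖feat l p - feat' l p‖ ≤ featDim D F (l - 1) * (d + c * s) := by
    intro l hl hlD p hp s d hprev
    constructor
    · calc ‖feat' l p‖ = ‖σ (∑ q ∈ Finset.range (featDim D F (l - 1)),
            H' l p q (feat' (l - 1) q)) - σ 0‖ := by rw [hσ0, sub_zero, hrec' l hl hlD p hp]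
        _ ≤ ‖∑ q ∈ Finset.range (featDim D F (l - 1)), H' l p q (feat' (l - 1) q)‖ := by
            simpa using hσ _ 0
        _ ≤ ∑ _q ∈ Finset.range (featDim D F (l - 1)), s :=
            norm_sum_le_of_le _ fun q hq =>
              (hH' l p q hl hlD hp (Finset.mem_range.1 hq) _).trans
                (hprev q (Finset.mem_range.1 hq)).1
        _ = _ := by simp
    · rw [hrec l hl hlD p hp, hrec' l hl hlD p hp]
      refine (hσ _ _).trans ?_
      rw [← Finset.sum_sub_distrib]
      calc _ ≤ ∑ _q ∈ Finset.range (featDim D F (l - 1)), (d + c * s) := by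
            refine norm_sum_le_of_le _ fun q hq => ?_
            have hq := Finset.mem_range.1 hq
            rw [← sub_add_sub_cancel _ (H l p q (feat' (l - 1) q))]
            refine (norm_add_le _ _).trans (add_le_add ?_ ?_)
            · exact (hH l p q hl hlD hp hq _ _).trans (hprev q hq).2
            · exact (hHH' l p q hl hlD hp hq _).trans
                (mul_le_mul_of_nonneg_left (hprev q hq).1 hc)
        _ = _ := by simp [mul_add]
  induction l, hl using Nat.le_induction with
  | base =>
    intro hD p hp
    have := step 1 le_rfl hD p hp ‖feat' 0 0‖ 0 fun q hq => by
      obtain rfl : q = 0 := by simpa [featDim] using hq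
      simp [h₀]
    simpa [featDim] using this
  | succ l hl ih =>
    intro hD p hp
    have := step (l + 1) (by omega) hD p hp _ _ (ih (by omega))
    have hdim : featDim D F l = F := if_neg (by omega)
    have hpow : (F : ℝ) ^ l = F * F ^ (l - 1) := by
      rw [← pow_succ', Nat.sub_add_cancel hl]
    rw [Nat.add_sub_cancel, hdim] at this
    rw [Nat.add_sub_cancel, hpow]
    refine ⟨this.1.trans_eq (by ring), this.2.trans_eq ?_⟩
    push_cast
    ring

/-- **Theorem 1 (stability of manifold neural networks), finite-dimensional self-adjoint
version.** Let `L` be self-adjoint with an `α`-separated spectral partition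
`Λ 1 ∪ ... ∪ Λ N`, and let `L' = L + A` with `A` self-adjoint, `‖A‖ = ε`, `0 < ε < α`.
Consider a `D`-layer neural network whose layer-`l` features are
`feat l p = σ (∑ q, h_l^{pq}(L) (feat (l-1) q))`, with `F₀ = F_D = 1` and `F` features in
the hidden layers, where each filter function is `B`-Lipschitz, non-amplifying, and an
`α`-FDT filter with threshold `π ε / (2(α - ε))` on the (associated) spectra of `L` and
`L'`, and `σ` is `1`-Lipschitz with `σ 0 = 0`. Then the outputs on `L` and on `L'`
satisfy `‖Φ(L,f) - Φ(L',f)‖ ≤ D F^{D-1} (N π/(α-ε) + B) ε ‖f‖`. -/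
theorem mnn_stability
    {E : Type*} [NormedAddCommGroup E] [InnerProductSpace ℝ E] [FiniteDimensional ℝ E]
    {n N : ℕ} (L A : E →L[ℝ] E)
    (hLsym : ∀ x y : E, ⟪L x, y⟫ = ⟪x, L y⟫)
    (hAsym : ∀ x y : E, ⟪A x, y⟫ = ⟪x, A y⟫)
    (α ε : ℝ) (hε0 : 0 < ε) (hεα : ε < α) (hAnorm : ‖A‖ = ε)
    (μ μ' : Fin n → ℝ) (hμ : Monotone μ) (hμ' : Monotone μ')
    (b b' : OrthonormalBasis (Fin n) ℝ E)
    (hb : ∀ i, L (b i) = μ i • b i)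
    (hb' : ∀ i, (L + A) (b' i) = μ' i • b' i)
    (Λ : Fin N → Set ℝ) (κ : Fin n → Fin N)
    (hκ : ∀ i, μ i ∈ Λ (κ i))
    (hpart : ∀ k, Λ k ⊆ Set.range μ)
    (hsep : ∀ k l : Fin N, k ≠ l → ∀ x ∈ Λ k, ∀ y ∈ Λ l, α < |x - y|)
    (D F : ℕ) (hD : 1 ≤ D) (hF : 1 ≤ F)
    (hfun : ℕ → ℕ → ℕ → ℝ → ℝ) (B : ℝ)
    (hLip : ∀ l p q, 1 ≤ l → l ≤ D → p < featDim D F l → q < featDim D F (l - 1) →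
      ∀ a c : ℝ, |hfun l p q a - hfun l p q c| ≤ B * |a - c|)
    (hbd : ∀ l p q, 1 ≤ l → l ≤ D → p < featDim D F l → q < featDim D F (l - 1) →
      ∀ x : ℝ, |hfun l p q x| ≤ 1)
    (hFDT : ∀ l p q, 1 ≤ l → l ≤ D → p < featDim D F l → q < featDim D F (l - 1) →
      ∀ i j : Fin n, κ i = κ j →
        |hfun l p q (μ i) - hfun l p q (μ j)| ≤ Real.pi * ε / (2 * (α - ε)) ∧
        |hfun l p q (μ i) - hfun l p q (μ' j)| ≤ Real.pi * ε / (2 * (α - ε)) ∧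
        |hfun l p q (μ' i) - hfun l p q (μ' j)| ≤ Real.pi * ε / (2 * (α - ε)))
    (σ : E → E) (hσ : ∀ a c : E, ‖σ a - σ c‖ ≤ ‖a - c‖) (hσ0 : σ 0 = 0)
    (f : E) (feat feat' : ℕ → ℕ → E)
    (hfeat₀ : feat 0 0 = f) (hfeat₀' : feat' 0 0 = f)
    (hrec : ∀ l, 1 ≤ l → l ≤ D → ∀ p < featDim D F l,
      feat l p = σ (∑ q ∈ Finset.range (featDim D F (l - 1)),
        ∑ i, (hfun l p q (μ i) * ⟪feat (l - 1) q, b i⟫) • b i))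
    (hrec' : ∀ l, 1 ≤ l → l ≤ D → ∀ p < featDim D F l,
      feat' l p = σ (∑ q ∈ Finset.range (featDim D F (l - 1)),
        ∑ i, (hfun l p q (μ' i) * ⟪feat' (l - 1) q, b' i⟫) • b' i)) :
    ‖feat D 0 - feat' D 0‖
      ≤ (D : ℝ) * (F : ℝ) ^ (D - 1) * ((N : ℝ) * Real.pi / (α - ε) + B) * ε * ‖f‖ := by
  have hδ : 0 < α - ε := sub_pos.2 hεα
  have hsep' : ∀ i j, κ i ≠ κ j → α - ε ≤ |μ i - μ' j| := fun i j hij => by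
    have h1 := hsep _ _ hij _ (hκ i) _ (hκ j)
    have h2 := abs_eigenvalue_sub_le hLsym hAsym hμ hμ' b b' hb hb' j
    have h3 := abs_sub_le (μ i) (μ' j) (μ j)
    linarith
  have hmain := norm_network_sub_le (c := N * Real.pi * ε / (α - ε))
    (fun l p q => spectralFilter b μ (hfun l p q))
    (fun l p q => spectralFilter b' μ' (hfun l p q))
    (fun l p q hl hlD hp hq v w => by
      rw [← spectralFilter_sub]
      exact norm_spectralFilter_le b μ (hbd l p q hl hlD hp hq) _)
    (fun l p q hl hlD hp hq v => norm_spectralFilter_le b' μ' (hbd l p q hl hlD hp hq) v)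
    (fun l p q hl hlD hp hq v => norm_spectralFilter_sub_le hLsym hε0 hδ hAnorm.le hb hb' κ hsep'
      (hbd l p q hl hlD hp hq) (hFDT l p q hl hlD hp hq) v)
    σ hσ hσ0 feat feat' (hfeat₀.trans hfeat₀'.symm) hrec hrec' (by positivity) D hD le_rfl 0
    (by simp [featDim])
  have hB : 0 ≤ B := by
    have h1 := hLip 1 0 0 le_rfl hD (by unfold featDim; split_ifs <;> omega)
      (by simp [featDim]) 1 0
    have h2 := abs_nonneg (hfun 1 0 0 1 - hfun 1 0 0 0)
    norm_num at h1
    linarith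
  have hc : N * Real.pi * ε / (α - ε) ≤ (N * Real.pi / (α - ε) + B) * ε := by
    rw [add_mul, div_mul_eq_mul_div]
    exact le_add_of_nonneg_right (by positivity)
  calc ‖feat D 0 - feat' D 0‖
      ≤ D * F ^ (D - 1) * (N * Real.pi * ε / (α - ε)) * ‖f‖ := hfeat₀' ▸ hmain.2
    _ ≤ D * F ^ (D - 1) * ((N * Real.pi / (α - ε) + B) * ε) * ‖f‖ := by gcongr
    _ = _ := by ring
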